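/- Let A be a type and C a monoid (Mathlib's Monoid C). The multiplication ⊛ on the escrow set ⟨⟨A,C⟩⟩, sending ⟦M, h₁, h₂⟧ and ⟦N, k₁, k₂⟧ to ⟦M × N, fun a => let (m, x) := h₁ a; let (n, y) := k₁ a; ((m, n), x * y), fun q => h₂ (q.1.1, q.2) * k₂ (q.1.2, q.2)⟧, is associative: (h ⊛ k) ⊛ p = h ⊛ (k ⊛ p) for all h, k, p ∈ ⟨⟨A,C⟩⟩. -/

import Mathlib

/-- A representative of an optic: a residual type `M` with forward and backward parts. -/
def OpticRep (A B S T : Type) : Type 1 :=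
  Σ M : Type, (S → M × A) × (M × B → T)

/-- The generating relation for the optic quotient: sliding a map `f : M → N`
between the residuals of the two legs. -/
inductive OpticRel (A B S T : Type) : OpticRep A B S T → OpticRep A B S T → Prop
  | slide {M N : Type} (f : M → N) (u : S → M × A) (v : N × B → T) :
      OpticRel A B S T ⟨M, u, fun p => v (f p.1, p.2)⟩
        ⟨N, fun s => (f (u s).1, (u s).2), v⟩

/-- `∼` : the equivalence relation generated by the generating relation. -/
def opticSim {A B S T : Type} : OpticRep A B S T → OpticRep A B S T → Prop :=
  Relation.EqvGen (OpticRel A B S T)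

/-- The set (type) of optics: representatives modulo `∼`. -/
def Optic (A B S T : Type) : Type 1 :=
  Quot (OpticRel A B S T)

/-- The class `⟦M, u, v⟧` of a representative. -/
def Optic.mk {A B S T : Type} (x : OpticRep A B S T) : Optic A B S T :=
  Quot.mk (OpticRel A B S T) x

/-- Escrow representatives: representatives of `⟨⟨T,S⟩⟩ := Optic S T T S`,
i.e. triples `⟨M, h₁ : T → M × S, h₂ : M × T → S⟩`. -/
abbrev EscrowRep (T S : Type) : Type 1 := OpticRep S T T S

/-- The set of escrows `⟨⟨T,S⟩⟩ := Optic S T T S`. -/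
abbrev Escrow (T S : Type) : Type 1 := Optic S T T S

/-- The convolution-style multiplication `⊛` on representatives of `⟨⟨A,C⟩⟩`,
for `A` a (diagonal) comonoid and `C` a monoid. -/
def mulRep {A C : Type} [Monoid C] (h k : EscrowRep A C) : EscrowRep A C :=
  ⟨h.1 × k.1,
   fun a => (((h.2.1 a).1, (k.2.1 a).1), (h.2.1 a).2 * (k.2.1 a).2),
   fun q => h.2.2 (q.1.1, q.2) * k.2.2 (q.1.2, q.2)⟩

/-- the multiplication `⊛` on `⟨⟨A,C⟩⟩` is associative. -/
theorem statement8 (A C : Type) [Monoid C] (h k p : EscrowRep A C) :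
    Optic.mk (mulRep (mulRep h k) p) = Optic.mk (mulRep h (mulRep k p)) := by
  have slide := OpticRel.slide (Equiv.prodAssoc h.1 k.1 p.1)
    (mulRep (mulRep h k) p).2.1 (mulRep h (mulRep k p)).2.2
  simp only [mulRep, Equiv.prodAssoc_apply, ← mul_assoc] at slide
  simp only [Optic.mk, mulRep, ← mul_assoc]
  exact Quot.sound slide
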